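/- (Lemma on the upper unipotent orbit of ξ_+) The map ν_+ : N_n → M_{n+1}(F), u ↦ u·ξ_+ (that is, u ↦ diag(u,1)·ξ_+·diag(u,1)^{-1}), is a bijection from N_n onto 𝒱_+. -/

import Mathlib

open Matrix MeasureTheory

namespace ZhangRTF

variable {F : Type*} [Field F] {n : ℕ}

/-- Block diagonal embedding `diag(h,1) ∈ M_{n+1}(F)` of `h ∈ M_n(F)`. -/
def emb (h : Matrix (Fin n) (Fin n) F) : Matrix (Fin (n + 1)) (Fin (n + 1)) F :=
  Matrix.of fun i j =>
    if hi : (i : ℕ) < n then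
      (if hj : (j : ℕ) < n then h ⟨i, hi⟩ ⟨j, hj⟩ else 0)
    else (if (j : ℕ) < n then 0 else 1)

/-- Conjugation action of `GL_n(F)` on `M_{n+1}(F)`: `h·X = diag(h,1) X diag(h,1)⁻¹`. -/
def act (h : Matrix.GeneralLinearGroup (Fin n) F)
    (X : Matrix (Fin (n + 1)) (Fin (n + 1)) F) : Matrix (Fin (n + 1)) (Fin (n + 1)) F :=
  emb (h : Matrix (Fin n) (Fin n) F) * X *
    emb ((h⁻¹ : Matrix.GeneralLinearGroup (Fin n) F) : Matrix (Fin n) (Fin n) F)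

/-- The upper-left `n × n` block `A` of `X = [[A,u],[v,w]]`. -/
def blockA (X : Matrix (Fin (n + 1)) (Fin (n + 1)) F) : Matrix (Fin n) (Fin n) F :=
  Matrix.of fun i j => X i.castSucc j.castSucc

/-- The upper-right column `u` of `X = [[A,u],[v,w]]`. -/
def blockU (X : Matrix (Fin (n + 1)) (Fin (n + 1)) F) : Fin n → F :=
  fun i => X i.castSucc (Fin.last n)

/-- The lower-left row `v` of `X = [[A,u],[v,w]]`. -/
def blockV (X : Matrix (Fin (n + 1)) (Fin (n + 1)) F) : Fin n → F :=
  fun j => X (Fin.last n) j.castSucc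

/-- The lower-right corner `w` of `X = [[A,u],[v,w]]`. -/
def blockW (X : Matrix (Fin (n + 1)) (Fin (n + 1)) F) : F :=
  X (Fin.last n) (Fin.last n)

/-- `δ₊(X)`: the matrix whose `j`-th column is `A^{n-j} u` (`1 ≤ j ≤ n`, 1-indexed). -/
def deltaPlus (X : Matrix (Fin (n + 1)) (Fin (n + 1)) F) : Matrix (Fin n) (Fin n) F :=
  Matrix.of fun i j => (blockA X ^ (n - 1 - (j : ℕ)) *ᵥ blockU X) i

/-- `δ₋(X)`: the matrix whose `i`-th row is `v A^{i-1}` (`1 ≤ i ≤ n`, 1-indexed). -/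
def deltaMinus (X : Matrix (Fin (n + 1)) (Fin (n + 1)) F) : Matrix (Fin n) (Fin n) F :=
  Matrix.of fun i j => (blockV X ᵥ* blockA X ^ (i : ℕ)) j

/-- `Δ₊(X) = det δ₊(X)`. -/
def DeltaPlus (X : Matrix (Fin (n + 1)) (Fin (n + 1)) F) : F := (deltaPlus X).det

/-- `Δ₋(X) = det δ₋(X)`. -/
def DeltaMinus (X : Matrix (Fin (n + 1)) (Fin (n + 1)) F) : F := (deltaMinus X).det

/-- The `a`-invariants: `a_i = -(coefficient of T^{n-i} in charpoly A)` (1-indexed). -/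
noncomputable def aInv (X : Matrix (Fin (n + 1)) (Fin (n + 1)) F) : Fin n → F :=
  fun i => -((blockA X).charpoly.coeff (n - 1 - (i : ℕ)))

/-- The `b`-invariants: `b_0 = w` and `b_j = v A^{j-1} u` for `1 ≤ j ≤ n`. -/
def bInv (X : Matrix (Fin (n + 1)) (Fin (n + 1)) F) : Fin (n + 1) → F :=
  fun j => if (j : ℕ) = 0 then blockW X
    else blockV X ⬝ᵥ (blockA X ^ ((j : ℕ) - 1) *ᵥ blockU X)

/-- The invariants map `π : M_{n+1}(F) → F^n × F^{n+1}`. -/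
noncomputable def invMap (X : Matrix (Fin (n + 1)) (Fin (n + 1)) F) : (Fin n → F) × (Fin (n + 1) → F) :=
  (aInv X, bInv X)

/-- The regular nilpotent `ξ₊`: `(i,i+1)`-entries equal to `1`, all others `0`. -/
def xiPlus (n : ℕ) : Matrix (Fin (n + 1)) (Fin (n + 1)) F :=
  Matrix.of fun i j => if (j : ℕ) = (i : ℕ) + 1 then 1 else 0

/-- The section `σ(a,b)` of the invariants map. -/
def sectSigma (a : Fin n → F) (b : Fin (n + 1) → F) : Matrix (Fin (n + 1)) (Fin (n + 1)) F :=
  Matrix.of fun i j =>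
    if hi : (i : ℕ) < n then
      (if (j : ℕ) = 0 then a ⟨i, hi⟩ else 0) + (if (j : ℕ) = (i : ℕ) + 1 then 1 else 0)
    else b j.rev

/-- The variant section `σ'(a,b)`. -/
def sectSigma' (a : Fin n → F) (b : Fin (n + 1) → F) : Matrix (Fin (n + 1)) (Fin (n + 1)) F :=
  Matrix.of fun i j =>
    if (i : ℕ) < n - 1 then (if (j : ℕ) = (i : ℕ) + 1 then 1 else 0)
    else if (i : ℕ) = n - 1 then
      (if hj : (j : ℕ) < n then a ⟨n - 1 - (j : ℕ), by omega⟩ else 1)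
    else b j.rev

/-- Membership in `N_{n,-}`: lower triangular with unit diagonal. -/
def IsLowerUni (h : Matrix (Fin n) (Fin n) F) : Prop :=
  (∀ i, h i i = 1) ∧ ∀ i j : Fin n, i < j → h i j = 0

/-- Membership in `N_n`: upper triangular with unit diagonal. -/
def IsUpperUni (h : Matrix (Fin n) (Fin n) F) : Prop :=
  (∀ i, h i i = 1) ∧ ∀ i j : Fin n, j < i → h i j = 0

/-- Membership in the subvariety `𝒲`: superdiagonal entries `1`,
entries above the superdiagonal `0`. -/
def memW (X : Matrix (Fin (n + 1)) (Fin (n + 1)) F) : Prop :=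
  ∀ i j : Fin (n + 1),
    ((j : ℕ) = (i : ℕ) + 1 → X i j = 1) ∧ ((i : ℕ) + 1 < (j : ℕ) → X i j = 0)

/-- `p : 𝒲 → 𝒱`, replacing the last row by zero. -/
def pMap (X : Matrix (Fin (n + 1)) (Fin (n + 1)) F) : Matrix (Fin (n + 1)) (Fin (n + 1)) F :=
  Matrix.of fun i j => if (i : ℕ) = n then 0 else X i j

/-- `p' : 𝒲 → 𝒱'`, replacing the last row and the first column by zero. -/
def pMap' (X : Matrix (Fin (n + 1)) (Fin (n + 1)) F) : Matrix (Fin (n + 1)) (Fin (n + 1)) F :=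
  Matrix.of fun i j => if (i : ℕ) = n ∨ (j : ℕ) = 0 then 0 else X i j

/-- The determinant of an element of `GL_n(F)`, as a unit of `F`. -/
def GLdet (h : Matrix.GeneralLinearGroup (Fin n) F) : Fˣ :=
  Units.map Matrix.detMonoidHom h

end ZhangRTF

open ZhangRTF

namespace ZhangRTF

theorem aux_emb_cc {F : Type*} [Field F] {n : ℕ} (h : Matrix (Fin n) (Fin n) F) (i j : Fin n) :
    emb h i.castSucc j.castSucc = h i j := by
  simp [emb]

theorem aux_emb_cl {F : Type*} [Field F] {n : ℕ} (h : Matrix (Fin n) (Fin n) F) (i : Fin n) :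
    emb h i.castSucc (Fin.last n) = 0 := by
  simp [emb]

theorem aux_emb_lc {F : Type*} [Field F] {n : ℕ} (h : Matrix (Fin n) (Fin n) F) (j : Fin n) :
    emb h (Fin.last n) j.castSucc = 0 := by
  simp [emb]

theorem aux_emb_ll {F : Type*} [Field F] {n : ℕ} (h : Matrix (Fin n) (Fin n) F) :
    emb h (Fin.last n) (Fin.last n) = 1 := by
  simp [emb]

theorem aux_emb_mul {F : Type*} [Field F] {n : ℕ} (a b : Matrix (Fin n) (Fin n) F) :
    emb a * emb b = emb (a * b) := by
  ext i j
  rw [Matrix.mul_apply, Fin.sum_univ_castSucc]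
  induction i using Fin.lastCases <;> induction j using Fin.lastCases <;>
    simp [aux_emb_cc, aux_emb_cl, aux_emb_lc, aux_emb_ll, Matrix.mul_apply]

theorem aux_emb_one {F : Type*} [Field F] {n : ℕ} :
    emb (1 : Matrix (Fin n) (Fin n) F) = 1 := by
  ext i j
  induction i using Fin.lastCases <;> induction j using Fin.lastCases <;>
    simp [aux_emb_cc, aux_emb_cl, aux_emb_lc, aux_emb_ll, Matrix.one_apply,
      (Fin.castSucc_lt_last _).ne, (Fin.castSucc_lt_last _).ne']

theorem aux_act_iff {F : Type*} [Field F] {n : ℕ} (u : Matrix.GeneralLinearGroup (Fin n) F)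
    (X Y : Matrix (Fin (n + 1)) (Fin (n + 1)) F) :
    act u X = Y ↔ emb (u : Matrix (Fin n) (Fin n) F) * X = Y * emb (u : Matrix (Fin n) (Fin n) F) := by
  have h1 : emb (u : Matrix (Fin n) (Fin n) F) *
      emb ((u⁻¹ : Matrix.GeneralLinearGroup (Fin n) F) : Matrix (Fin n) (Fin n) F) = 1 := by
    rw [aux_emb_mul, ← Units.val_mul, mul_inv_cancel, Units.val_one, aux_emb_one]
  have h2 : emb ((u⁻¹ : Matrix.GeneralLinearGroup (Fin n) F) : Matrix (Fin n) (Fin n) F) *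
      emb (u : Matrix (Fin n) (Fin n) F) = 1 := by
    rw [aux_emb_mul, ← Units.val_mul, inv_mul_cancel, Units.val_one, aux_emb_one]
  unfold act
  constructor
  · rintro rfl
    rw [Matrix.mul_assoc, h2, Matrix.mul_one]
  · intro h
    rw [h, Matrix.mul_assoc, h1, Matrix.mul_one]

theorem aux_xi_zero {F : Type*} [Field F] {n : ℕ} (M : Matrix (Fin (n + 1)) (Fin (n + 1)) F)
    (i : Fin (n + 1)) : (M * xiPlus (F := F) n : Matrix (Fin (n + 1)) (Fin (n + 1)) F) i 0 = 0 := by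
  simp [Matrix.mul_apply, xiPlus]

theorem aux_xi_succ {F : Type*} [Field F] {n : ℕ} (M : Matrix (Fin (n + 1)) (Fin (n + 1)) F)
    (i : Fin (n + 1)) (j : Fin n) : (M * xiPlus (F := F) n : Matrix (Fin (n + 1)) (Fin (n + 1)) F) i j.succ = M i j.castSucc := by
  rw [Matrix.mul_apply, Finset.sum_eq_single j.castSucc]
  · simp [xiPlus]
  · intro b _ hb
    have : ¬ ((j : ℕ) = (b : ℕ)) := fun h => hb (Fin.ext h.symm)
    simp [xiPlus, this]
  · simp

theorem aux_emb_upper {F : Type*} [Field F] {n : ℕ} {h : Matrix (Fin n) (Fin n) F}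
    (hu : IsUpperUni h) : IsUpperUni (emb h) := by
  refine ⟨fun i => ?_, fun i j hij => ?_⟩
  · induction i using Fin.lastCases with
    | last => exact aux_emb_ll h
    | cast i => rw [aux_emb_cc]; exact hu.1 i
  · induction j using Fin.lastCases with
    | last => exact absurd hij (not_lt.2 (Fin.le_last i))
    | cast j =>
      induction i using Fin.lastCases with
      | last => exact aux_emb_lc h j
      | cast i => rw [aux_emb_cc]; exact hu.2 i j (by simpa using hij)

theorem aux_col {F : Type*} [Field F] {n : ℕ} (h : Matrix (Fin n) (Fin n) F)
    (X : Matrix (Fin (n + 1)) (Fin (n + 1)) F) (hX : emb h * xiPlus n = X * emb h) (k : ℕ) :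
    ∀ i j : Fin (n + 1), (j : ℕ) + k = n → emb h i j = (X ^ k) i (Fin.last n) := by
  induction k with
  | zero =>
    intro i j hj
    have : j = Fin.last n := Fin.ext (by simpa using hj)
    subst this
    induction i using Fin.lastCases with
    | last => simp [aux_emb_ll]
    | cast i => simp [aux_emb_cl, Matrix.one_apply, (Fin.castSucc_lt_last _).ne]
  | succ k ih =>
    intro i j hj
    obtain ⟨j, rfl⟩ : ∃ j' : Fin n, j = j'.castSucc := ⟨⟨j, by omega⟩, rfl⟩
    rw [← aux_xi_succ (emb h) i j, hX, pow_succ', Matrix.mul_apply, Matrix.mul_apply]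
    refine Finset.sum_congr rfl fun l _ => ?_
    rw [ih l j.succ (by simp at hj ⊢; omega)]

theorem aux_pow {F : Type*} [Field F] {n : ℕ} (X : Matrix (Fin (n + 1)) (Fin (n + 1)) F)
    (hX : ∀ i j : Fin (n + 1),
          ((j : ℕ) = (i : ℕ) + 1 → X i j = 1) ∧ ((j : ℕ) ≤ (i : ℕ) → X i j = 0)) (k : ℕ) :
    ∀ i j : Fin (n + 1), ((j : ℕ) = (i : ℕ) + k → (X ^ k) i j = 1) ∧
      ((j : ℕ) < (i : ℕ) + k → (X ^ k) i j = 0) := by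
  induction k with
  | zero =>
    intro i j
    refine ⟨fun h => ?_, fun h => ?_⟩
    · have : i = j := Fin.ext (by omega)
      simp [this]
    · have : i ≠ j := by rintro rfl; omega
      simp [this]
  | succ k ih =>
    intro i j
    rw [pow_succ', Matrix.mul_apply]
    refine ⟨fun h => ?_, fun h => ?_⟩
    · rw [Finset.sum_eq_single (⟨(i : ℕ) + 1, by omega⟩ : Fin (n + 1))]
      · rw [(hX _ _).1 rfl, (ih _ _).1 (by simp; omega), one_mul]
      · intro l _ hl
        have hl' : (l : ℕ) ≠ (i : ℕ) + 1 := fun e => hl (Fin.ext e)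
        rcases le_or_gt (l : ℕ) (i : ℕ) with h1 | h1
        · rw [(hX _ _).2 h1, zero_mul]
        · rw [(ih _ _).2 (by omega), mul_zero]
      · simp
    · refine Finset.sum_eq_zero fun l _ => ?_
      rcases le_or_gt (l : ℕ) (i : ℕ) with h1 | h1
      · rw [(hX _ _).2 h1, zero_mul]
      · rw [(ih _ _).2 (by omega), mul_zero]

theorem aux_mapsTo {F : Type*} [Field F] {n : ℕ} {U X : Matrix (Fin (n + 1)) (Fin (n + 1)) F}
    (hU : IsUpperUni U) (hX : U * xiPlus n = X * U) (i : Fin (n + 1)) :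
    ∀ (m : ℕ) (j : Fin (n + 1)), (j : ℕ) = m →
      (((j : ℕ) = (i : ℕ) + 1 → X i j = 1) ∧ ((j : ℕ) ≤ (i : ℕ) → X i j = 0)) := by
  intro m
  induction m using Nat.strong_induction_on with
  | _ m ih =>
    intro j hj
    have key : (j : ℕ) ≤ (i : ℕ) + 1 → X i j = (U * xiPlus (F := F) n : Matrix (Fin (n + 1)) (Fin (n + 1)) F) i j := by
      intro hji
      rw [hX, Matrix.mul_apply, Finset.sum_eq_single j]
      · rw [hU.1, mul_one]
      · intro l _ hl
        have hl' : (l : ℕ) ≠ (j : ℕ) := fun e => hl (Fin.ext e)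
        rcases lt_or_gt_of_ne hl' with h1 | h1
        · rw [(ih l (by omega) l rfl).2 (by omega), zero_mul]
        · rw [hU.2 l j h1, mul_zero]
      · simp
    refine ⟨fun h => ?_, fun h => ?_⟩
    · rw [key h.le]
      obtain ⟨j, rfl⟩ : ∃ j' : Fin n, j = j'.succ := ⟨⟨i, by omega⟩, Fin.ext h⟩
      rw [aux_xi_succ]
      have : i = j.castSucc := Fin.ext (by simp at h ⊢; omega)
      rw [this, hU.1]
    · rw [key (by omega)]
      induction j using Fin.cases with
      | zero => exact aux_xi_zero _ _
      | succ j =>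
        rw [aux_xi_succ]
        exact hU.2 _ _ (by rw [Fin.lt_def]; simp at h ⊢; omega)

theorem aux_surj {F : Type*} [Field F] {n : ℕ} (X : Matrix (Fin (n + 1)) (Fin (n + 1)) F)
    (hX : ∀ i j : Fin (n + 1),
          ((j : ℕ) = (i : ℕ) + 1 → X i j = 1) ∧ ((j : ℕ) ≤ (i : ℕ) → X i j = 0)) :
    ∃ u : Matrix.GeneralLinearGroup (Fin n) F, IsUpperUni (u : Matrix (Fin n) (Fin n) F) ∧
      act u (xiPlus n) = X := by
  have hp := aux_pow X hX
  let M : Matrix (Fin n) (Fin n) F :=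
    Matrix.of fun i j => (X ^ (n - (j : ℕ))) i.castSucc (Fin.last n)
  have hM : IsUpperUni M := by
    refine ⟨fun i => (hp _ _ _).1 ?_, fun i j hij => (hp _ _ _).2 ?_⟩
    · simp
    · rw [Fin.lt_def] at hij
      simp; omega
  have hdet : M.det = 1 := by
    rw [Matrix.det_of_upperTriangular (fun i j hij => hM.2 i j hij)]
    simp [hM.1]
  have hE : ∀ i j : Fin (n + 1), emb M i j = (X ^ (n - (j : ℕ))) i (Fin.last n) := by
    intro i j
    induction j using Fin.lastCases with
    | last =>
      induction i using Fin.lastCases with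
      | last => simp [aux_emb_ll]
      | cast i => simp [aux_emb_cl, Matrix.one_apply, (Fin.castSucc_lt_last _).ne]
    | cast j =>
      induction i using Fin.lastCases with
      | last => rw [aux_emb_lc, (hp _ _ _).2 (by simp)]
      | cast i => rw [aux_emb_cc]; rfl
  refine ⟨Matrix.GeneralLinearGroup.mkOfDetNeZero M (by rw [hdet]; exact one_ne_zero), hM, ?_⟩
  rw [aux_act_iff]
  change emb M * xiPlus n = X * emb M
  ext i j
  have hr : (X * emb M) i j = (X ^ (n - (j : ℕ) + 1)) i (Fin.last n) := by
    rw [pow_succ', Matrix.mul_apply, Matrix.mul_apply]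
    exact Finset.sum_congr rfl fun l _ => by rw [hE]
  rw [hr]
  induction j using Fin.cases with
  | zero => rw [aux_xi_zero, (hp _ _ _).2 (by simp; omega)]
  | succ j =>
    have e : n - ((j.succ : Fin (n + 1)) : ℕ) + 1 = n - ((j.castSucc : Fin (n + 1)) : ℕ) := by
      simp only [Fin.val_succ, Fin.val_castSucc]
      omega
    rw [aux_xi_succ, hE, e]

end ZhangRTF

/-- The map `u ↦ u·ξ₊` is a bijection from `N_n` onto `𝒱₊`. -/
theorem nu_plus_bijection (n : ℕ) (hn : 1 ≤ n) (F : Type*) [Field F] :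
    Set.BijOn (fun u : Matrix.GeneralLinearGroup (Fin n) F => act u (xiPlus n))
      {u : Matrix.GeneralLinearGroup (Fin n) F | IsUpperUni (u : Matrix (Fin n) (Fin n) F)}
      {X : Matrix (Fin (n + 1)) (Fin (n + 1)) F |
        ∀ i j : Fin (n + 1),
          ((j : ℕ) = (i : ℕ) + 1 → X i j = 1) ∧ ((j : ℕ) ≤ (i : ℕ) → X i j = 0)} := by
  refine ⟨fun u hu i j => ?_, fun u _ v _ huv => ?_, fun X hX => ?_⟩
  · exact aux_mapsTo (aux_emb_upper hu) ((aux_act_iff u _ _).1 rfl) i _ j rfl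
  · have h1 := (aux_act_iff u (xiPlus n) _).1 rfl
    have h2 := (aux_act_iff v (xiPlus n) _).1 huv.symm
    apply Units.ext
    ext i j
    rw [← aux_emb_cc (u : Matrix (Fin n) (Fin n) F), ← aux_emb_cc (v : Matrix (Fin n) (Fin n) F),
      aux_col _ _ h1 (n - j) _ _ (by simp), aux_col _ _ h2 (n - j) _ _ (by simp)]
  · exact aux_surj X hX
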